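/- Let κ ∈ ℂ, let μ > 0 be real, let c ∈ [−1, 1] and let z ∈ ℂ. Then the series Σ_{ℓ=0}^∞ ((μ−κ+1/2)_ℓ / (2μ)_{2ℓ}) · z^ℓ · ₁F₁(ℓ+μ−κ+1/2; 2ℓ+2μ+1; z) · C_ℓ^{(μ)}(c) converges, and its sum equals ₁F₁(μ−κ+1/2; μ+1/2; ((1+c)/2)·z). -/

import Mathlib

open scoped BigOperators

noncomputable section

/-- Ascending Pochhammer symbol `(a)_n = a (a+1) ⋯ (a+n-1)`. -/
def aP (n : ℕ) (a : ℂ) : ℂ := (ascPochhammer ℂ n).eval a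

/-- The confluent hypergeometric function `₁F₁(a; b; z) = ∑_n ((a)_n / ((b)_n n!)) z^n`. -/
def hyp1F1 (a b z : ℂ) : ℂ :=
  ∑' n : ℕ, aP n a / (aP n b * (n.factorial : ℂ)) * z ^ n

/-- The Gegenbauer polynomial
`C_ℓ^{(μ)}(x) = ∑_{k=0}^{⌊ℓ/2⌋} (-1)^k ((μ)_{ℓ-k} / (k! (ℓ-2k)!)) (2x)^{ℓ-2k}`. -/
def gegenbauerC (μ : ℂ) (ℓ : ℕ) (x : ℂ) : ℂ :=
  ∑ k ∈ Finset.range (ℓ / 2 + 1),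
    (-1) ^ k * aP (ℓ - k) μ / ((k.factorial : ℂ) * ((ℓ - 2 * k).factorial : ℂ)) *
      (2 * x) ^ (ℓ - 2 * k)

lemma aP_zero (a : ℂ) : aP 0 a = 1 := by simp [aP]

lemma aP_succ (n : ℕ) (a : ℂ) : aP (n + 1) a = aP n a * (a + n) := by
  simp [aP, ascPochhammer_succ_eval]

lemma aP_add (m n : ℕ) (a : ℂ) : aP (m + n) a = aP m a * aP n (a + m) := by
  induction n with
  | zero => simp [aP_zero]
  | succ n ih => rw [← add_assoc, aP_succ, ih, aP_succ]; push_cast; ring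

lemma aP_ne_zero {a : ℂ} (h : ∀ k : ℕ, a + k ≠ 0) (n : ℕ) : aP n a ≠ 0 := by
  induction n with
  | zero => simp [aP_zero]
  | succ n ih => rw [aP_succ]; exact mul_ne_zero ih (h n)

lemma norm_aP_le (n : ℕ) (a : ℂ) : ‖aP n a‖ ≤ (1 + ‖a‖) ^ n * n.factorial := by
  induction n with
  | zero => simp [aP_zero]
  | succ n ih =>
    rw [aP_succ, norm_mul, pow_succ, Nat.factorial_succ]
    have h : ‖a + n‖ ≤ (1 + ‖a‖) * (n + 1) := by
      have h1 := norm_add_le a n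
      rw [Complex.norm_natCast] at h1
      nlinarith [mul_nonneg (norm_nonneg a) (Nat.cast_nonneg (α := ℝ) n)]
    calc _ ≤ ((1 + ‖a‖) ^ n * n.factorial) * ((1 + ‖a‖) * (n + 1)) := by gcongr
      _ = _ := by push_cast; ring

lemma le_norm_aP {δ M : ℝ} (hδ : 0 ≤ δ) (hδ1 : δ ≤ 1) (hM : δ ≤ M) (n : ℕ) :
    δ ^ n * n.factorial ≤ ‖aP n (M : ℂ)‖ := by
  induction n with
  | zero => simp [aP_zero]
  | succ n ih =>
    rw [aP_succ, norm_mul, pow_succ, Nat.factorial_succ]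
    have h : δ * (n + 1) ≤ ‖(M : ℂ) + n‖ := by
      have h1 : ‖(M : ℂ) + n‖ = |M + n| := by
        rw [← Complex.ofReal_natCast, ← Complex.ofReal_add, Complex.norm_real, Real.norm_eq_abs]
      rw [h1]
      refine le_trans ?_ (le_abs_self _)
      nlinarith [Nat.cast_nonneg (α := ℝ) n]
    calc _ = (δ ^ n * n.factorial) * (δ * (n + 1)) := by push_cast; ring
      _ ≤ _ := by gcongr

/-- The `k`-th summand of the Gegenbauer polynomial of degree `ℓ`, extended by zero. -/
def gegenbauerTerm (μ x : ℂ) (ℓ k : ℕ) : ℂ :=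
  if 2 * k ≤ ℓ then
    (-1) ^ k * aP (ℓ - k) μ / ((k.factorial : ℂ) * ((ℓ - 2 * k).factorial : ℂ)) *
      (2 * x) ^ (ℓ - 2 * k)
  else 0

lemma gegenbauerC_eq_sum (μ x : ℂ) {ℓ K : ℕ} (h : ℓ / 2 + 1 ≤ K) :
    gegenbauerC μ ℓ x = ∑ k ∈ Finset.range K, gegenbauerTerm μ x ℓ k := by
  have h0 : gegenbauerC μ ℓ x = ∑ k ∈ Finset.range (ℓ / 2 + 1), gegenbauerTerm μ x ℓ k := by
    refine Finset.sum_congr rfl fun k hk => ?_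
    rw [Finset.mem_range] at hk
    rw [gegenbauerTerm, if_pos (by omega)]
  rw [h0]
  refine Finset.sum_subset (Finset.range_mono h) fun k _ hk => ?_
  rw [Finset.mem_range] at hk
  rw [gegenbauerTerm, if_neg (by omega)]

lemma gegenbauerTerm_zero_recurrence (μ x : ℂ) (n : ℕ) :
    (n + 2) * gegenbauerTerm μ x (n + 2) 0 =
      (n + 1 + μ) * (2 * x) * gegenbauerTerm μ x (n + 1) 0 := by
  have h1 : (n : ℂ) + 1 ≠ 0 := by exact_mod_cast n.succ_ne_zero
  have h2 : (n : ℂ) + 1 + 1 ≠ 0 := by exact_mod_cast (n + 1).succ_ne_zero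
  have h3 : (n.factorial : ℂ) ≠ 0 := by exact_mod_cast n.factorial_ne_zero
  simp only [gegenbauerTerm, mul_zero, Nat.zero_le, if_true, Nat.sub_zero, pow_zero,
    Nat.factorial_zero, Nat.cast_one, one_mul, aP_succ, Nat.factorial_succ]
  push_cast
  field_simp
  ring

lemma gegenbauerTerm_succ_recurrence (μ x : ℂ) (n k : ℕ) :
    (n + 2) * gegenbauerTerm μ x (n + 2) (k + 1) =
      (n + 1 + μ) * (2 * x) * gegenbauerTerm μ x (n + 1) (k + 1)
        - (n + 2 * μ) * gegenbauerTerm μ x n k := by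
  by_cases hk : 2 * k ≤ n
  · obtain ⟨m, rfl⟩ := Nat.exists_eq_add_of_le hk
    have h1 : (k : ℂ) + 1 ≠ 0 := by exact_mod_cast k.succ_ne_zero
    have h3 : (k.factorial : ℂ) ≠ 0 := by exact_mod_cast k.factorial_ne_zero
    have e1 : 2 * k + m + 2 - (k + 1) = (k + m) + 1 := by omega
    have e2 : 2 * k + m + 2 - 2 * (k + 1) = m := by omega
    have e3 : 2 * k + m + 1 - (k + 1) = k + m := by omega
    have e4 : 2 * k + m - k = k + m := by omega
    have e5 : 2 * k + m - 2 * k = m := by omega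
    have e6 : 2 * k + m + 1 - 2 * (k + 1) = m - 1 := by omega
    rw [gegenbauerTerm, if_pos (show 2 * (k + 1) ≤ 2 * k + m + 2 by omega), gegenbauerTerm,
      gegenbauerTerm, if_pos (show 2 * k ≤ 2 * k + m by omega), e1, e2, e3, e4, e5, e6, aP_succ]
    rcases m with _ | m
    · rw [if_neg (by omega)]
      simp only [Nat.factorial_succ, Nat.factorial_zero]
      push_cast
      field_simp
      ring
    · rw [if_pos (by omega)]
      have h2 : (m : ℂ) + 1 ≠ 0 := by exact_mod_cast m.succ_ne_zero
      have h4 : (m.factorial : ℂ) ≠ 0 := by exact_mod_cast m.factorial_ne_zero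
      simp only [Nat.add_sub_cancel, Nat.factorial_succ]
      push_cast
      field_simp
      ring
  · rw [gegenbauerTerm, if_neg (by omega), gegenbauerTerm, if_neg (by omega), gegenbauerTerm,
      if_neg (by omega)]
    ring

lemma gegenbauerC_zero (μ x : ℂ) : gegenbauerC μ 0 x = 1 := by
  simp [gegenbauerC, aP_zero]

lemma gegenbauerC_one (μ x : ℂ) : gegenbauerC μ 1 x = 2 * μ * x := by
  simp [gegenbauerC, aP]; ring

/-- The three-term recurrence of the Gegenbauer polynomials. -/
lemma gegenbauerC_recurrence (μ x : ℂ) (n : ℕ) :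
    (n + 2) * gegenbauerC μ (n + 2) x =
      2 * (n + 1 + μ) * x * gegenbauerC μ (n + 1) x - (n + 2 * μ) * gegenbauerC μ n x := by
  rw [gegenbauerC_eq_sum μ x (ℓ := n + 2) (K := n + 2) (by omega),
    gegenbauerC_eq_sum μ x (ℓ := n + 1) (K := n + 2) (by omega),
    gegenbauerC_eq_sum μ x (ℓ := n) (K := n + 1) (by omega),
    Finset.sum_range_succ' _ (n + 1),
    Finset.sum_range_succ' (gegenbauerTerm μ x (n + 1)) (n + 1), mul_add, mul_add,
    gegenbauerTerm_zero_recurrence, Finset.mul_sum, Finset.mul_sum, Finset.mul_sum,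
    Finset.sum_congr rfl fun k _ => gegenbauerTerm_succ_recurrence μ x n k,
    Finset.sum_sub_distrib,
    show 2 * (n + 1 + μ) * x = (n + 1 + μ) * (2 * x) by ring]
  ring

lemma norm_gegenbauerC_le {μ c : ℝ} (hμ : 0 < μ) (hc : |c| ≤ 1) (ℓ : ℕ) :
    ‖gegenbauerC (μ : ℂ) ℓ (c : ℂ)‖ ≤ (3 * (1 + μ)) ^ ℓ := by
  induction ℓ using Nat.twoStepInduction with
  | zero => simp [gegenbauerC_zero]
  | one =>
    rw [gegenbauerC_one, norm_mul, norm_mul, Complex.norm_real, Complex.norm_real,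
      Real.norm_eq_abs, Real.norm_eq_abs, abs_of_pos hμ, Complex.norm_ofNat, pow_one]
    nlinarith
  | more n h0 h1 =>
    have hn : (0 : ℝ) ≤ n := n.cast_nonneg
    have key := congrArg norm (gegenbauerC_recurrence (μ : ℂ) (c : ℂ) n)
    have e1 : ‖((n : ℂ) + 2)‖ = n + 2 := by
      rw [show (n : ℂ) + 2 = ((n + 2 : ℕ) : ℂ) by push_cast; rfl, Complex.norm_natCast]
      push_cast; rfl
    have e2 : ‖(2 * ((n : ℂ) + 1 + μ) * c)‖ ≤ 2 * (n + 1 + μ) := by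
      rw [show (2 * ((n : ℂ) + 1 + μ) * c) = ((2 * (n + 1 + μ) * c : ℝ) : ℂ) by push_cast; rfl,
        Complex.norm_real, Real.norm_eq_abs, abs_mul, abs_of_pos (by positivity)]
      exact mul_le_of_le_one_right (by positivity) hc
    have e3 : ‖((n : ℂ) + 2 * μ)‖ = n + 2 * μ := by
      rw [show ((n : ℂ) + 2 * μ) = ((n + 2 * μ : ℝ) : ℂ) by push_cast; rfl,
        Complex.norm_real, Real.norm_eq_abs, abs_of_nonneg (by positivity)]
    rw [norm_mul, e1] at key
    set R : ℝ := 3 * (1 + μ) with hR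
    have h2 : (n + 2) * ‖gegenbauerC (μ : ℂ) (n + 2) (c : ℂ)‖ ≤
        2 * (n + 1 + μ) * R ^ (n + 1) + (n + 2 * μ) * R ^ n := by
      rw [key]
      refine (norm_sub_le _ _).trans ?_
      rw [norm_mul _ (gegenbauerC _ (n + 1) _), norm_mul _ (gegenbauerC _ n _), e3]
      gcongr
    have hRn : 0 ≤ R ^ n := by positivity
    have h3 : 2 * (n + 1 + μ) * R + (n + 2 * μ) ≤ (n + 2) * R ^ 2 := by
      rw [hR]; nlinarith [mul_nonneg hn hμ.le, mul_nonneg hn (mul_nonneg hμ.le hμ.le)]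
    refine le_of_mul_le_mul_left (h2.trans ?_) (show (0 : ℝ) < n + 2 by positivity)
    calc _ = (2 * (n + 1 + μ) * R + (n + 2 * μ)) * R ^ n := by ring
      _ ≤ ((n + 2) * R ^ 2) * R ^ n := by gcongr
      _ = _ := by ring

lemma sum_mul_gegenbauerC (μ x : ℂ) (v : ℕ → ℂ) (K : ℕ) :
    ∑ ℓ ∈ Finset.range (K + 1), 2 * (ℓ + μ) * x * gegenbauerC μ ℓ x * v ℓ =
      ∑ ℓ ∈ Finset.range (K + 1),
        gegenbauerC μ ℓ x * (ℓ * v (ℓ - 1) + (ℓ + 2 * μ) * v (ℓ + 1))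
      + (K + 1) * gegenbauerC μ (K + 1) x * v K
      - (K + 2 * μ) * gegenbauerC μ K x * v (K + 1) := by
  induction K with
  | zero => simp [gegenbauerC_zero, gegenbauerC_one]
  | succ K ih =>
    rw [Finset.sum_range_succ, ih, Finset.sum_range_succ _ (K + 1)]
    have h := gegenbauerC_recurrence μ x K
    simp only [Nat.add_sub_cancel]
    push_cast
    linear_combination -(v (K + 1)) * h

/-- The expansion of `((1 + x) / 2) ^ N` in Gegenbauer polynomials. -/
lemma sum_gegenbauerC_eq_pow {μ : ℂ} (hμ : ∀ k : ℕ, 2 * μ + k ≠ 0) (x : ℂ) (N : ℕ) :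
    ∑ ℓ ∈ Finset.range (N + 1), gegenbauerC μ ℓ x *
        ((2 * μ + 2 * ℓ) * N.descFactorial ℓ / aP (N + ℓ + 1) (2 * μ)) =
      ((1 + x) / 2) ^ N / aP N (μ + 1 / 2) := by
  induction N with
  | zero =>
    have h0 := hμ 0
    simp only [Nat.cast_zero, add_zero] at h0
    simpa [gegenbauerC_zero, aP_succ, aP_zero] using h0
  | succ N ih =>
    have hP := aP_ne_zero hμ
    have hN : 2 * μ + 1 + 2 * N ≠ 0 := by
      have h := hμ (2 * N + 1)
      push_cast at h
      intro h'; apply h; rw [← h']; ring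
    set v : ℕ → ℂ := fun ℓ => N.descFactorial ℓ / aP (N + ℓ + 1) (2 * μ) with hv
    have v1 : v (N + 1) = 0 := by simp [hv]
    have v2 : v (N + 2) = 0 := by
      simp [hv]
    have hx := sum_mul_gegenbauerC μ x v (N + 1)
    rw [v1, v2, mul_zero, mul_zero, add_zero, sub_zero] at hx
    have coef : ∀ ℓ : ℕ, (2 * μ + 2 * ℓ) * v ℓ + (ℓ * v (ℓ - 1) + (ℓ + 2 * μ) * v (ℓ + 1)) =
        (2 * μ + 1 + 2 * N) *
          ((2 * μ + 2 * ℓ) * (N + 1).descFactorial ℓ / aP (N + 1 + ℓ + 1) (2 * μ)) := by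
      intro ℓ
      rcases ℓ with _ | j
      · have a0 := hP (N + 1)
        have a1 := hμ (N + 1)
        simp only [hv, Nat.descFactorial_zero, Nat.descFactorial_one, add_zero, zero_add,
          aP_succ (N + 1), Nat.cast_zero, Nat.cast_one, mul_zero, zero_mul]
        push_cast at a1 ⊢
        field_simp
        ring
      · have a0 := hP (N + j + 1)
        have a1 := hμ (N + j + 1)
        have a2 := hμ (N + j + 2)
        rw [show N + 1 + (j + 1) + 1 = N + j + 1 + 1 + 1 by ring]
        simp only [hv, Nat.add_sub_cancel]
        rw [show N + (j + 1) + 1 = N + j + 1 + 1 by ring,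
          show N + (j + 1 + 1) + 1 = N + j + 1 + 1 + 1 by ring,
          aP_succ (N + j + 1 + 1), aP_succ (N + j + 1), Nat.succ_descFactorial_succ]
        have d1 : ((N.descFactorial (j + 1) : ℕ) : ℂ) = (N - j) * N.descFactorial j := by
          rw [Nat.descFactorial_succ]
          rcases le_or_gt j N with h | h
          · push_cast [h]; ring
          · simp [Nat.descFactorial_eq_zero_iff_lt.2 h]
        have d2 : ((N.descFactorial (j + 1 + 1) : ℕ) : ℂ) =
            (N - j - 1) * ((N - j) * N.descFactorial j) := by
          rw [← d1, Nat.descFactorial_succ]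
          rcases le_or_gt (j + 1) N with h | h
          · push_cast [h]; ring
          · rw [Nat.descFactorial_eq_zero_iff_lt.2 h]; simp
        rw [d1, d2]
        push_cast at a1 a2 ⊢
        have a2' : 2 * μ + ((N : ℂ) + j + 1 + 1) ≠ 0 := by
          intro h; apply a2; rw [← h]; ring
        field_simp
        ring
    have ih' : ∑ ℓ ∈ Finset.range (N + 1 + 1), gegenbauerC μ ℓ x * ((2 * μ + 2 * ℓ) * v ℓ) =
        ((1 + x) / 2) ^ N / aP N (μ + 1 / 2) := by
      rw [Finset.sum_range_succ, v1, mul_zero, mul_zero, add_zero, ← ih]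
      refine Finset.sum_congr rfl fun ℓ _ => ?_
      rw [hv]; ring
    have step : (2 * μ + 1 + 2 * N) * ∑ ℓ ∈ Finset.range (N + 1 + 1), gegenbauerC μ ℓ x *
        ((2 * μ + 2 * ℓ) * (N + 1).descFactorial ℓ / aP (N + 1 + ℓ + 1) (2 * μ)) =
        (1 + x) * (((1 + x) / 2) ^ N / aP N (μ + 1 / 2)) := by
      rw [add_mul 1 x, one_mul]
      nth_rewrite 1 [← ih']
      rw [← ih', Finset.mul_sum _ _ x,
        Finset.sum_congr rfl (fun ℓ _ => show x * (gegenbauerC μ ℓ x * ((2 * μ + 2 * ℓ) * v ℓ)) =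
          2 * (ℓ + μ) * x * gegenbauerC μ ℓ x * v ℓ by ring), hx, ← Finset.sum_add_distrib,
        Finset.mul_sum]
      refine Finset.sum_congr rfl fun ℓ _ => ?_
      linear_combination -(gegenbauerC μ ℓ x) * coef ℓ
    have hN' : μ + 1 / 2 + N = (2 * μ + 1 + 2 * N) / 2 := by ring
    refine mul_left_cancel₀ hN (step.trans ?_)
    rw [aP_succ, hN', pow_succ]
    field_simp

lemma summable_gegenbauerC_series {μ c : ℝ} (hμ : 0 < μ) (hc : |c| ≤ 1) (a z : ℂ) :
    Summable fun p : ℕ × ℕ =>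
      aP p.1 a / aP (2 * p.1) (2 * (μ : ℂ)) * z ^ p.1 *
        (aP p.2 (a + p.1) / (aP p.2 (2 * p.1 + 2 * μ + 1) * (p.2.factorial : ℂ)) * z ^ p.2) *
        gegenbauerC (μ : ℂ) p.1 (c : ℂ) := by
  set δ : ℝ := min (2 * μ) 1
  have hδ : 0 < δ := lt_min (by positivity) one_pos
  set B : ℝ := 2 * (1 + ‖a‖) * ‖z‖ with hB
  have hs := (Real.summable_pow_div_factorial (B * (3 * (1 + μ)) / δ ^ 2)).mul_of_nonneg
    (Real.summable_pow_div_factorial B) (fun n => by positivity) (fun n => by positivity)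
  refine Summable.of_norm_bounded hs fun p => ?_
  obtain ⟨l, n⟩ := p
  have h1 := norm_aP_le (l + n) a
  have h2 := le_norm_aP hδ.le (min_le_right _ _) (min_le_left (2 * μ) 1) (2 * l)
  have h3 := le_norm_aP (M := 2 * l + 2 * μ + 1) zero_le_one le_rfl
    (by have : (0 : ℝ) ≤ l := l.cast_nonneg
        linarith) n
  have h4 := norm_gegenbauerC_le hμ hc l
  rw [one_pow, one_mul] at h3
  push_cast at h2 h3
  have h5 : ((l + n).factorial : ℝ) ≤ 2 ^ (l + n) * (l.factorial * n.factorial) := by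
    rw [← Nat.add_choose_mul_factorial_mul_factorial]
    push_cast
    rw [mul_assoc]
    gcongr
    exact_mod_cast Nat.choose_le_two_pow _ _
  have h6 : (l.factorial * l.factorial : ℝ) ≤ (2 * l).factorial := by
    rw [two_mul]
    exact_mod_cast Nat.le_of_dvd (Nat.factorial_pos _)
      (Nat.factorial_mul_factorial_dvd_factorial_add l l)
  have e : ‖aP l a / aP (2 * l) (2 * (μ : ℂ)) * z ^ l *
        (aP n (a + l) / (aP n (2 * l + 2 * μ + 1) * (n.factorial : ℂ)) * z ^ n) *
        gegenbauerC (μ : ℂ) l (c : ℂ)‖ =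
      ‖aP (l + n) a‖ * ‖z‖ ^ (l + n) * ‖gegenbauerC (μ : ℂ) l (c : ℂ)‖ /
        (‖aP (2 * l) (2 * (μ : ℂ))‖ * (‖aP n (2 * l + 2 * μ + 1)‖ * n.factorial)) := by
    rw [aP_add]
    simp only [norm_mul, norm_div, norm_pow, Complex.norm_natCast]
    ring
  have f1 : (0 : ℝ) < l.factorial := by positivity
  have f2 : (0 : ℝ) < n.factorial := by positivity
  rw [e]
  calc _ ≤ ((1 + ‖a‖) ^ (l + n) * (2 ^ (l + n) * (l.factorial * n.factorial))) *
          ‖z‖ ^ (l + n) * (3 * (1 + μ)) ^ l /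
        (δ ^ (2 * l) * (l.factorial * l.factorial) * (n.factorial * n.factorial)) := by
        gcongr
        · exact h1.trans (by gcongr)
        · exact le_trans (by gcongr) h2
    _ = _ := by
        rw [hB]
        simp only [div_pow, mul_pow, pow_add, pow_mul]
        field_simp

lemma sum_antidiagonal_gegenbauerC_series {μ : ℂ} (hμ : ∀ k : ℕ, 2 * μ + k ≠ 0)
    (a x z : ℂ) (N : ℕ) :
    ∑ p ∈ Finset.HasAntidiagonal.antidiagonal N,
      aP p.1 a / aP (2 * p.1) (2 * μ) * z ^ p.1 *
        (aP p.2 (a + p.1) / (aP p.2 (2 * p.1 + 2 * μ + 1) * (p.2.factorial : ℂ)) * z ^ p.2) *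
        gegenbauerC μ p.1 x =
      aP N a / (aP N (μ + 1 / 2) * (N.factorial : ℂ)) * ((1 + x) / 2 * z) ^ N := by
  have h : aP N a / (aP N (μ + 1 / 2) * (N.factorial : ℂ)) * ((1 + x) / 2 * z) ^ N =
      aP N a * z ^ N / N.factorial * (((1 + x) / 2) ^ N / aP N (μ + 1 / 2)) := by
    rw [mul_pow]; ring
  rw [h, ← sum_gegenbauerC_eq_pow hμ x N, Finset.mul_sum,
    ← Finset.Nat.sum_antidiagonal_eq_sum_range_succ (fun ℓ _ => aP N a * z ^ N / N.factorial *
      (gegenbauerC μ ℓ x * ((2 * μ + 2 * ℓ) * N.descFactorial ℓ / aP (N + ℓ + 1) (2 * μ))))]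
  refine Finset.sum_congr rfl fun p hp => ?_
  obtain ⟨l, n⟩ := p
  rw [Finset.HasAntidiagonal.mem_antidiagonal] at hp
  subst hp
  have hP := aP_ne_zero hμ
  have q : aP (l + n + l + 1) (2 * μ) =
      aP (2 * l) (2 * μ) * (2 * μ + 2 * l) * aP n (2 * l + 2 * μ + 1) := by
    rw [show l + n + l + 1 = 2 * l + 1 + n by ring, aP_add, aP_succ]
    push_cast
    rw [show 2 * μ + (2 * l + 1) = 2 * (l : ℂ) + 2 * μ + 1 by ring]
  have d : ((l + n).factorial : ℂ) = n.factorial * (l + n).descFactorial l := by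
    have := Nat.factorial_mul_descFactorial (Nat.le_add_right l n)
    rw [Nat.add_sub_cancel_left] at this
    exact_mod_cast this.symm
  have q0 := hP (l + n + l + 1)
  have d0 : ((l + n).factorial : ℂ) ≠ 0 := by exact_mod_cast (l + n).factorial_ne_zero
  rw [q] at q0
  rw [d] at d0
  obtain ⟨q1, q2⟩ := mul_ne_zero_iff.1 q0
  obtain ⟨q3, q4⟩ := mul_ne_zero_iff.1 q1
  obtain ⟨d1, d2⟩ := mul_ne_zero_iff.1 d0
  simp only
  rw [q, d, aP_add]
  generalize aP n (2 * (l : ℂ) + 2 * μ + 1) = Q at *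
  generalize aP (2 * l) (2 * μ) = Q' at *
  generalize 2 * μ + 2 * (l : ℂ) = Q'' at *
  field_simp
  ring

/-- A summation formula for the confluent hypergeometric functions and Gegenbauer polynomials. -/
theorem hyp1F1_gegenbauer_summation (κ : ℂ) (μ : ℝ) (hμ : 0 < μ) (c : ℝ)
    (hc : c ∈ Set.Icc (-1 : ℝ) 1) (z : ℂ) :
    HasSum
      (fun ℓ : ℕ =>
        aP ℓ ((μ : ℂ) - κ + 1 / 2) / aP (2 * ℓ) (2 * (μ : ℂ)) * z ^ ℓ *
          hyp1F1 ((ℓ : ℂ) + μ - κ + 1 / 2) (2 * ℓ + 2 * μ + 1) z * gegenbauerC (μ : ℂ) ℓ (c : ℂ))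
      (hyp1F1 ((μ : ℂ) - κ + 1 / 2) ((μ : ℂ) + 1 / 2) ((1 + (c : ℂ)) / 2 * z)) := by
  have hc' : |c| ≤ 1 := abs_le.2 hc
  have hμ' : ∀ k : ℕ, 2 * (μ : ℂ) + k ≠ 0 := fun k => by
    have h : (2 * μ + k : ℝ) ≠ 0 := by positivity
    exact_mod_cast h
  set a : ℂ := (μ : ℂ) - κ + 1 / 2 with ha
  have hs := summable_gegenbauerC_series hμ hc' a z
  obtain ⟨S, hS⟩ := id hs
  have hdiag := ((Finset.HasAntidiagonal.sigmaAntidiagonalEquivProd (A := ℕ)).hasSum_iff.2 hS).sigma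
    fun N => hasSum_fintype _
  have hval : hyp1F1 a ((μ : ℂ) + 1 / 2) ((1 + (c : ℂ)) / 2 * z) = S := by
    refine Eq.trans (tsum_congr fun N => ?_) hdiag.tsum_eq
    rw [← sum_antidiagonal_gegenbauerC_series hμ', ← Finset.sum_coe_sort]
    rfl
  rw [hval]
  refine HasSum.prod_fiberwise (g := fun ℓ : ℕ => _) hS fun ℓ => ?_
  have hℓ := (hs.prod_factor ℓ).hasSum
  simp only [tsum_mul_right, tsum_mul_left] at hℓ
  rw [hyp1F1, show (ℓ : ℂ) + μ - κ + 1 / 2 = a + ℓ by rw [ha]; ring]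
  exact hℓ
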